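/- arXiv:2010.03619 — 2 statements merged into one kernel-verified Lean document; each statement's English description precedes it below -/
import Mathlib

section
/- Fix r > 0 and M > √π/(2√r), and let z > 0 satisfy √(2r)·(M − z)·F(√(2r)·z) = Ψ(√(2r)·z). Then the quantity b := √r·M·Ψ(√(2r)·z) / (√2·φ(√(2r)·z)) satisfies b < 1. -/
/-- The standard normal density `φ(z) = exp(-z²/2)/√(2π)`. -/
noncomputable def npdf (z : ℝ) : ℝ := (Real.sqrt (2 * Real.pi))⁻¹ * Real.exp (-z ^ 2 / 2)

/-- The standard normal distribution function `Φ(y) = ∫_{-∞}^y φ(z) dz`. -/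
noncomputable def ncdf (y : ℝ) : ℝ := ∫ z in Set.Iic y, npdf z

/-- The standard normal tail function `Ψ(y) = 1 - Φ(y)`. -/
noncomputable def ntail (y : ℝ) : ℝ := 1 - ncdf y

/-- The function `F(y) = φ(y) - y·Ψ(y)`. -/
noncomputable def Fstat (y : ℝ) : ℝ := npdf y - y * ntail y

open Filter Topology MeasureTheory

lemma aux_npdf_cont : Continuous npdf := by unfold npdf; fun_prop

lemma aux_npdf_pos (y : ℝ) : 0 < npdf y := by unfold npdf; positivity

lemma aux_npdf_int : Integrable npdf := by
  have h := (integrable_exp_neg_mul_sq (b := 1/2) (by norm_num)).const_mul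
    (Real.sqrt (2 * Real.pi))⁻¹
  refine h.congr (Eventually.of_forall fun x => ?_)
  simp only [npdf]
  congr 2
  ring

lemma aux_npdf_integral : ∫ x, npdf x = 1 := by
  have h := integral_gaussian (1/2)
  have h2 : ∫ x, npdf x = (Real.sqrt (2 * Real.pi))⁻¹ * ∫ x : ℝ, Real.exp (-(1/2) * x ^ 2) := by
    rw [← integral_const_mul]
    refine integral_congr_ae (Eventually.of_forall fun x => ?_)
    simp only [npdf]
    congr 2
    ring
  rw [h2, h, show Real.pi / (1/2) = 2 * Real.pi by ring]
  exact inv_mul_cancel₀ (by positivity)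

lemma aux_npdf_deriv (y : ℝ) : HasDerivAt npdf (-y * npdf y) y := by
  have h1 : HasDerivAt (fun x : ℝ => -x ^ 2 / 2) (-y) y := by
    have h0 : HasDerivAt (fun x : ℝ => x ^ 2) (2 * y) y := by simpa using hasDerivAt_pow 2 y
    exact (h0.neg.div_const 2).congr_deriv (by ring)
  have := h1.exp.const_mul (Real.sqrt (2 * Real.pi))⁻¹
  exact this.congr_deriv (by simp only [npdf]; ring)

lemma aux_ntail_deriv (y : ℝ) : HasDerivAt ntail (-npdf y) y := by
  have h1 : ncdf = fun x => ncdf 0 + ∫ t in (0:ℝ)..x, npdf t := by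
    funext x
    have := intervalIntegral.integral_Iic_sub_Iic (aux_npdf_int.integrableOn (s := Set.Iic 0))
      (aux_npdf_int.integrableOn (s := Set.Iic x))
    simp only [ncdf]
    linarith
  have h2 : HasDerivAt ncdf (npdf y) y := by
    rw [h1]
    exact (intervalIntegral.integral_hasDerivAt_right (aux_npdf_cont.intervalIntegrable _ _)
      aux_npdf_cont.stronglyMeasurable.stronglyMeasurableAtFilter
      aux_npdf_cont.continuousAt).const_add _
  exact h2.const_sub 1

lemma aux_ntail_tendsto : Tendsto ntail atTop (𝓝 0) := by
  have h : Tendsto ncdf atTop (𝓝 1) := by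
    rw [← aux_npdf_integral]
    exact (aecover_Iic tendsto_id).integral_tendsto_of_countably_generated aux_npdf_int
  have := h.const_sub 1
  rw [sub_self] at this
  exact this

lemma aux_npdf_tendsto : Tendsto npdf atTop (𝓝 0) := by
  have h : Tendsto (fun x : ℝ => -x ^ 2 / 2) atTop atBot := by
    have h1 : Tendsto (fun x : ℝ => x ^ 2 / 2) atTop atTop :=
      (tendsto_pow_atTop two_ne_zero).atTop_div_const (by norm_num)
    have := tendsto_neg_atTop_atBot.comp h1
    refine this.congr fun x => ?_
    simp only [Function.comp]
    ring
  have := (Real.tendsto_exp_atBot.comp h).const_mul (Real.sqrt (2 * Real.pi))⁻¹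
  rw [mul_zero] at this
  exact this

lemma aux_pos {f f' : ℝ → ℝ} (hf : ∀ x, 0 ≤ x → HasDerivAt f (f' x) x)
    (hneg : ∀ x, 0 ≤ x → f' x < 0) (ht : Tendsto f atTop (𝓝 0)) (y : ℝ) (hy : 0 ≤ y) :
    0 < f y := by
  have hs : StrictAntiOn f (Set.Ici 0) := by
    refine strictAntiOn_of_deriv_neg (convex_Ici 0)
      (fun x hx => (hf x hx).continuousAt.continuousWithinAt) fun x hx => ?_
    rw [interior_Ici] at hx
    have hx' : (0:ℝ) ≤ x := le_of_lt hx
    rw [(hf x hx').deriv]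
    exact hneg x hx'
  have h1 : f (y + 1) < f y := hs hy (show (0:ℝ) ≤ y + 1 by linarith) (by linarith)
  have h2 : 0 ≤ f (y + 1) := by
    refine le_of_tendsto ht ?_
    filter_upwards [eventually_ge_atTop (y + 1)] with x hx
    exact hs.antitoneOn (show (0:ℝ) ≤ y + 1 by linarith) (show (0:ℝ) ≤ x by linarith) hx
  linarith

lemma aux_ntail_pos (y : ℝ) (hy : 0 ≤ y) : 0 < ntail y :=
  aux_pos (fun x _ => aux_ntail_deriv x) (fun x _ => neg_neg_of_pos (aux_npdf_pos x))
    aux_ntail_tendsto y hy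

lemma aux_mills (y : ℝ) (hy : 0 ≤ y) :
    0 < npdf y * (4 / (3 * y + Real.sqrt (y ^ 2 + 8))) - ntail y := by
  refine aux_pos (f := fun y => npdf y * (4 / (3 * y + Real.sqrt (y ^ 2 + 8))) - ntail y)
    (f' := fun y => (-y * npdf y * (4 / (3 * y + Real.sqrt (y ^ 2 + 8))) +
      npdf y * ((0 * (3 * y + Real.sqrt (y ^ 2 + 8)) - 4 * (3 + y / Real.sqrt (y ^ 2 + 8))) /
        (3 * y + Real.sqrt (y ^ 2 + 8)) ^ 2)) - (-npdf y)) ?_ ?_ ?_ y hy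
  · intro x hx
    have hs : HasDerivAt (fun x : ℝ => Real.sqrt (x ^ 2 + 8)) (x / Real.sqrt (x ^ 2 + 8)) x := by
      have h0 : HasDerivAt (fun x : ℝ => x ^ 2) (2 * x) x := by simpa using hasDerivAt_pow 2 x
      exact ((h0.add_const 8).sqrt (by positivity)).congr_deriv (by field_simp)
    have h3 : HasDerivAt (fun x : ℝ => 3 * x + Real.sqrt (x ^ 2 + 8))
        (3 + x / Real.sqrt (x ^ 2 + 8)) x := by
      exact (((hasDerivAt_id x).const_mul 3).add hs).congr_deriv (by ring)
    exact ((aux_npdf_deriv x).mul ((hasDerivAt_const x (4:ℝ)).div h3 (by positivity))).sub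
      (aux_ntail_deriv x)
  · intro x hx
    have hp := aux_npdf_pos x
    have hs : 0 < Real.sqrt (x ^ 2 + 8) := by positivity
    have hs2 : Real.sqrt (x ^ 2 + 8) ^ 2 = x ^ 2 + 8 := Real.sq_sqrt (by positivity)
    set s := Real.sqrt (x ^ 2 + 8) with hsdef
    have hkey : x ^ 3 + 6 * x < s * (x ^ 2 + 2) := by
      refine lt_of_pow_lt_pow_left₀ 2 (by positivity) ?_
      rw [mul_pow, hs2]
      nlinarith
    have e : (-x * npdf x * (4 / (3 * x + s)) +
      npdf x * ((0 * (3 * x + s) - 4 * (3 + x / s)) / (3 * x + s) ^ 2)) - (-npdf x)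
      = npdf x * (2 * (x ^ 3 + 6 * x - s * (x ^ 2 + 2))) / (s * (3 * x + s) ^ 2) := by
      have : 3 * x + s ≠ 0 := by positivity
      field_simp
      linear_combination (s + 2 * x) * hs2
    rw [e]
    apply div_neg_of_neg_of_pos _ (by positivity)
    apply mul_neg_of_pos_of_neg hp
    linarith
  · have h1 : Tendsto (fun y : ℝ => 3 * y + Real.sqrt (y ^ 2 + 8)) atTop atTop :=
      tendsto_atTop_mono' _ (by
        filter_upwards [eventually_ge_atTop 0] with x hx
        have := Real.sqrt_nonneg (x ^ 2 + 8)
        show id x ≤ _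
        simp only [id]
        linarith) tendsto_id
    have := (aux_npdf_tendsto.mul (h1.const_div_atTop 4)).sub aux_ntail_tendsto
    simpa using this

/-- for r > 0, M > √π/(2√r) and z > 0 solving
√(2r)·(M−z)·F(√(2r)·z) = Ψ(√(2r)·z), the value
b = √r·M·Ψ(√(2r)·z)/(√2·φ(√(2r)·z)) satisfies b < 1. -/
theorem b_lt_one (r M z : ℝ) (hr : 0 < r)
    (hM : Real.sqrt Real.pi / (2 * Real.sqrt r) < M) (hz : 0 < z)
    (heq : Real.sqrt (2*r) * (M - z) * Fstat (Real.sqrt (2*r) * z)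
      = ntail (Real.sqrt (2*r) * z)) :
    Real.sqrt r * M * ntail (Real.sqrt (2*r) * z)
      / (Real.sqrt 2 * npdf (Real.sqrt (2*r) * z)) < 1 := by
  have hrs : 0 < Real.sqrt (2*r) := by positivity
  have hprod : Real.sqrt (2*r) = Real.sqrt 2 * Real.sqrt r := Real.sqrt_mul (by norm_num) r
  have h22 : Real.sqrt 2 * Real.sqrt 2 = 2 := Real.mul_self_sqrt (by norm_num)
  have h2p : 0 < Real.sqrt 2 := by positivity
  have hy : 0 < Real.sqrt (2*r) * z := by positivity
  have hmill := aux_mills _ hy.le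
  have hP := aux_ntail_pos _ hy.le
  have hp := aux_npdf_pos (Real.sqrt (2*r) * z)
  have heq' : (Real.sqrt (2*r) * M - Real.sqrt (2*r) * z) * Fstat (Real.sqrt (2*r) * z)
      = ntail (Real.sqrt (2*r) * z) := by rw [← heq]; ring
  rw [div_lt_one (by positivity)]
  suffices h : Real.sqrt (2*r) * M * ntail (Real.sqrt (2*r) * z)
      < 2 * npdf (Real.sqrt (2*r) * z) by
    refine lt_of_mul_lt_mul_left ?_ h2p.le
    calc _ = Real.sqrt (2*r) * M * ntail (Real.sqrt (2*r) * z) := by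
          rw [show ∀ a, ntail a = ntail a from fun _ => rfl]
          generalize ntail (Real.sqrt (2*r) * z) = q
          rw [hprod]; ring
      _ < _ := h
      _ = _ := by rw [← mul_assoc, h22]
  unfold Fstat at heq'
  generalize Real.sqrt (2*r) * M = m at *
  generalize Real.sqrt (2*r) * z = y at *
  generalize ntail y = P at *
  generalize npdf y = p at *
  have hs2 : Real.sqrt (y ^ 2 + 8) ^ 2 = y ^ 2 + 8 := Real.sq_sqrt (by positivity)
  have hsy : y < Real.sqrt (y ^ 2 + 8) := Real.lt_sqrt_of_sq_lt (by linarith)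
  generalize Real.sqrt (y ^ 2 + 8) = s at *
  have hd : 0 < 3 * y + s := by linarith
  have h1 : P * (3 * y + s) < 4 * p := by
    have : P < p * 4 / (3 * y + s) := by rw [← mul_div_assoc] at hmill; linarith
    rw [lt_div_iff₀ hd] at this
    linarith
  have h2 : P * (3 * y - s) < 4 * p := by nlinarith
  have hF : 0 < p - y * P := by nlinarith
  have hq : 0 < 2 * p ^ 2 - 3 * y * p * P + (y ^ 2 - 1) * P ^ 2 := by
    have h3 := mul_pos (sub_pos.2 h1) (sub_pos.2 h2)
    have e : (4 * p - P * (3 * y + s)) * (4 * p - P * (3 * y - s))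
        = 8 * (2 * p ^ 2 - 3 * y * p * P + (y ^ 2 - 1) * P ^ 2) := by
      linear_combination (-P ^ 2) * hs2
    linarith
  have hfin : (2 * p - m * P) * (p - y * P)
      = 2 * p ^ 2 - 3 * y * p * P + (y ^ 2 - 1) * P ^ 2 := by
    linear_combination (-P) * heq'
  have := pos_of_mul_pos_left (hfin ▸ hq) hF.le
  linarith
end

section
/- Fix r > 0, M > 0 and z > 0 satisfying √(2r)·(M − z)·F(√(2r)·z) = Ψ(√(2r)·z), and set b := √r·M·Ψ(√(2r)·z)/(√2·φ(√(2r)·z)). Then one has the identity 2r·(M − z)·(M − b·z) − b = √(2r)·M·Ψ(√(2r)·z)/(2·F(√(2r)·z)); in particular 2r·(M − z)·(M − b·z) > b. -/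
open MeasureTheory Filter Topology in
theorem setInt_pos (f : ℝ → ℝ) (y : ℝ) (hf : ∀ t ∈ Set.Ioi y, 0 < f t)
    (hi : IntegrableOn f (Set.Ioi y)) : 0 < ∫ t in Set.Ioi y, f t := by
  rw [setIntegral_pos_iff_support_of_nonneg_ae _ hi]
  · have : Function.support f ∩ Set.Ioi y = Set.Ioi y := by
      apply Set.inter_eq_right.mpr
      intro t ht
      exact (hf t ht).ne'
    rw [this]; simp
  · filter_upwards [ae_restrict_mem measurableSet_Ioi] with t ht
    exact (hf t ht).le

theorem npdf_pos (t : ℝ) : 0 < npdf t := by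
  unfold npdf; positivity

theorem npdf_eq : npdf = ProbabilityTheory.gaussianPDFReal 0 1 := by
  funext t
  simp [npdf, ProbabilityTheory.gaussianPDFReal]

theorem npdf_integrable : MeasureTheory.Integrable npdf := by
  rw [npdf_eq]; exact ProbabilityTheory.integrable_gaussianPDFReal 0 1

theorem ntail_eq (y : ℝ) : ntail y = ∫ t in Set.Ioi y, npdf t := by
  have h1 : ∫ t, npdf t = 1 := by
    rw [npdf_eq]; exact ProbabilityTheory.integral_gaussianPDFReal_eq_one 0 one_ne_zero
  have h2 := MeasureTheory.integral_add_compl (measurableSet_Iic (a := y)) npdf_integrable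
  rw [Set.compl_Iic, h1] at h2
  unfold ntail ncdf
  linarith

theorem ntail_pos (y : ℝ) : 0 < ntail y := by
  rw [ntail_eq]
  exact setInt_pos _ _ (fun t _ => npdf_pos t) npdf_integrable.integrableOn

theorem npdf_deriv (t : ℝ) : HasDerivAt (fun t => - npdf t) (t * npdf t) t := by
  unfold npdf
  have h : HasDerivAt (fun t : ℝ => -t ^ 2 / 2) (-t) t := by
    have := ((hasDerivAt_pow 2 t).neg).div_const 2
    exact this.congr_deriv (by norm_num; ring)
  have := ((h.exp).const_mul ((Real.sqrt (2 * Real.pi))⁻¹)).neg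
  exact this.congr_deriv (by ring)

open MeasureTheory Filter Topology in
theorem Fstat_pos (y : ℝ) (hy : 0 < y) : 0 < Fstat y := by
  have ht : Tendsto (fun t => - npdf t) atTop (𝓝 0) := by
    unfold npdf
    have h1 : Tendsto (fun t : ℝ => -t ^ 2 / 2) atTop atBot := by
      have h := (tendsto_pow_atTop (α := ℝ) (two_ne_zero)).atTop_div_const (two_pos)
      have h' := tendsto_neg_atTop_atBot.comp h
      refine h'.congr fun t => ?_
      simp only [Function.comp]; ring
    have h2 := ((Real.tendsto_exp_atBot.comp h1).const_mul ((Real.sqrt (2 * Real.pi))⁻¹)).neg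
    simpa using h2
  have hpos : ∀ t ∈ Set.Ioi y, 0 ≤ t * npdf t := fun t h =>
    mul_nonneg (hy.le.trans (le_of_lt h)) (npdf_pos t).le
  have hI := integrableOn_Ioi_deriv_of_nonneg' (fun t _ => npdf_deriv t) hpos ht
  have hE := integral_Ioi_of_hasDerivAt_of_tendsto' (fun t _ => npdf_deriv t) hI ht
  have hJ : IntegrableOn (fun t => y * npdf t) (Set.Ioi y) :=
    (npdf_integrable.const_mul y).integrableOn
  have : Fstat y = ∫ t in Set.Ioi y, (t * npdf t - y * npdf t) := by
    rw [integral_sub hI hJ, hE, integral_const_mul, ← ntail_eq]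
    unfold Fstat; ring
  rw [this]
  refine setInt_pos _ _ (fun t h => ?_) (hI.sub hJ)
  rw [← sub_mul]
  exact mul_pos (sub_pos.mpr h) (npdf_pos t)

/-- with z > 0 solving √(2r)(M−z)F(√(2r)z) = Ψ(√(2r)z) and
b = √r·M·Ψ(√(2r)z)/(√2·φ(√(2r)z)), one has
2r(M−z)(M−bz) − b = √(2r)·M·Ψ(√(2r)z)/(2F(√(2r)z)); in particular
2r(M−z)(M−bz) > b. -/
theorem bA_identity (r M z b : ℝ) (hr : 0 < r) (hM : 0 < M) (hz : 0 < z)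
    (heq : Real.sqrt (2*r) * (M - z) * Fstat (Real.sqrt (2*r) * z)
      = ntail (Real.sqrt (2*r) * z))
    (hb : b = Real.sqrt r * M * ntail (Real.sqrt (2*r) * z)
      / (Real.sqrt 2 * npdf (Real.sqrt (2*r) * z))) :
    2 * r * (M - z) * (M - b * z) - b
      = Real.sqrt (2*r) * M * ntail (Real.sqrt (2*r) * z)
        / (2 * Fstat (Real.sqrt (2*r) * z)) ∧
    b < 2 * r * (M - z) * (M - b * z) := by
  have hs : 0 < Real.sqrt (2*r) := by positivity
  have hs2 : Real.sqrt (2*r) ^ 2 = 2 * r := Real.sq_sqrt (by positivity)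
  have h2 : Real.sqrt 2 ^ 2 = 2 := Real.sq_sqrt (by positivity)
  have hs' : Real.sqrt (2*r) = Real.sqrt 2 * Real.sqrt r := Real.sqrt_mul (by positivity) r
  have hF := Fstat_pos (Real.sqrt (2*r) * z) (by positivity)
  have hT := ntail_pos (Real.sqrt (2*r) * z)
  have hP := npdf_pos (Real.sqrt (2*r) * z)
  have hFd : Fstat (Real.sqrt (2*r) * z) = npdf (Real.sqrt (2*r) * z)
    - Real.sqrt (2*r) * z * ntail (Real.sqrt (2*r) * z) := rfl
  have hb2 : b = Real.sqrt (2*r) * M * ntail (Real.sqrt (2*r) * z)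
      / (2 * npdf (Real.sqrt (2*r) * z)) := by
    rw [hb, div_eq_div_iff (by positivity) (by positivity)]
    generalize ntail (Real.sqrt (2*r) * z) = T
    generalize npdf (Real.sqrt (2*r) * z) = P
    rw [hs']
    linear_combination (-(Real.sqrt r * M * T * P)) * h2
  clear hb hs'
  generalize ntail (Real.sqrt (2*r) * z) = T at *
  generalize npdf (Real.sqrt (2*r) * z) = P at *
  generalize Fstat (Real.sqrt (2*r) * z) = F at *
  generalize Real.sqrt (2*r) = s at *
  have key : 2 * r * (M - z) * (M - b * z) - b = s * M * T / (2 * F) := by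
    have e1 : 2 * r * (M - z) = s * T / F := by
      rw [eq_div_iff hF.ne', ← hs2, ← heq]; ring
    have e2 : M - b * z = M * (P + F) / (2 * P) := by
      rw [hb2, hFd]; field_simp; ring
    rw [e1, e2, hb2]; field_simp; ring
  refine ⟨key, ?_⟩
  have : 0 < s * M * T / (2 * F) := by positivity
  linarith
end
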